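/- arXiv:1410.3809 — 6 statements merged into one kernel-verified Lean document; each statement's English description precedes it below -/
import Mathlib

section
/- Under the generalized Minkowski curvature flow, the speed function satisfies the evolution equation ∂v/∂t(u,t) = −k(u,t)²·v(u,t) + (∂/∂t log a)(θ(u,t),t)·v(u,t) for every (u,t) ∈ ℝ × [0,T). -/
open Real Set

noncomputable def wedge (x y : ℝ × ℝ) : ℝ := x.1 * y.2 - x.2 * y.1

noncomputable def er (θ : ℝ) : ℝ × ℝ := (Real.cos θ, Real.sin θ)

noncomputable def etheta (θ : ℝ) : ℝ × ℝ := (-Real.sin θ, Real.cos θ)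

/-- partial derivative in the first (spatial) variable -/
noncomputable def pd (f : ℝ → ℝ → ℝ) (θ t : ℝ) : ℝ := deriv (fun x => f x t) θ

/-- partial derivative in the second (time) variable -/
noncomputable def pt (f : ℝ → ℝ → ℝ) (θ t : ℝ) : ℝ := deriv (fun s => f θ s) t

/-- partial derivative in the first variable, vector valued -/
noncomputable def pdv (f : ℝ → ℝ → ℝ × ℝ) (θ t : ℝ) : ℝ × ℝ := deriv (fun x => f x t) θ

/-- partial derivative in the second variable, vector valued -/
noncomputable def ptv (f : ℝ → ℝ → ℝ × ℝ) (θ t : ℝ) : ℝ × ℝ := deriv (fun s => f θ s) t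

section PartialDerivatives

variable {E : Type*} [NormedAddCommGroup E] [NormedSpace ℝ E] {f : ℝ → ℝ → E}

/-- Chain rule for a function of two real variables along a curve. -/
theorem hasDerivAt_uncurry_comp (hf : Differentiable ℝ (Function.uncurry f)) {x y : ℝ → ℝ}
    {x' y' s : ℝ} (hx : HasDerivAt x x' s) (hy : HasDerivAt y y' s) :
    HasDerivAt (fun r => f (x r) (y r))
      (fderiv ℝ (Function.uncurry f) (x s, y s) (x', y')) s :=
  (hf (x s, y s)).hasFDerivAt.comp_hasDerivAt (f := fun r => (x r, y r)) s (hx.prodMk hy)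

theorem deriv_fst_eq_fderiv (hf : Differentiable ℝ (Function.uncurry f)) (x t : ℝ) :
    deriv (fun y => f y t) x = fderiv ℝ (Function.uncurry f) (x, t) (1, 0) :=
  (hasDerivAt_uncurry_comp hf (hasDerivAt_id x) (hasDerivAt_const x t)).deriv

theorem deriv_snd_eq_fderiv (hf : Differentiable ℝ (Function.uncurry f)) (x t : ℝ) :
    deriv (fun s => f x s) t = fderiv ℝ (Function.uncurry f) (x, t) (0, 1) :=
  (hasDerivAt_uncurry_comp hf (hasDerivAt_const t x) (hasDerivAt_id t)).deriv

theorem hasDerivAt_uncurry_comp_partials (hf : Differentiable ℝ (Function.uncurry f))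
    {x y : ℝ → ℝ} {x' y' s : ℝ} (hx : HasDerivAt x x' s) (hy : HasDerivAt y y' s) :
    HasDerivAt (fun r => f (x r) (y r))
      (x' • deriv (fun z => f z (y s)) (x s) + y' • deriv (fun z => f (x s) z) (y s)) s := by
  convert hasDerivAt_uncurry_comp hf hx hy using 1
  rw [deriv_fst_eq_fderiv hf, deriv_snd_eq_fderiv hf, ← map_smul, ← map_smul, ← map_add]
  simp

theorem contDiff_deriv_fst (hf : ContDiff ℝ (⊤ : ℕ∞) (Function.uncurry f)) :
    ContDiff ℝ (⊤ : ℕ∞) (Function.uncurry fun x t => deriv (fun y => f y t) x) := by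
  have h : (Function.uncurry fun x t => deriv (fun y => f y t) x) =
      fun z => fderiv ℝ (Function.uncurry f) z (1, 0) :=
    funext fun z => deriv_fst_eq_fderiv (hf.differentiable (by simp)) z.1 z.2
  rw [h]
  exact (hf.fderiv_right (by simp)).clm_apply contDiff_const

theorem contDiff_deriv_snd (hf : ContDiff ℝ (⊤ : ℕ∞) (Function.uncurry f)) :
    ContDiff ℝ (⊤ : ℕ∞) (Function.uncurry fun x t => deriv (fun s => f x s) t) := by
  have h : (Function.uncurry fun x t => deriv (fun s => f x s) t) =
      fun z => fderiv ℝ (Function.uncurry f) z (0, 1) :=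
    funext fun z => deriv_snd_eq_fderiv (hf.differentiable (by simp)) z.1 z.2
  rw [h]
  exact (hf.fderiv_right (by simp)).clm_apply contDiff_const

/-- Mixed partial derivatives of a smooth function commute. -/
theorem deriv_deriv_comm (hf : ContDiff ℝ (⊤ : ℕ∞) (Function.uncurry f)) (x t : ℝ) :
    deriv (fun y => deriv (fun s => f y s) t) x =
      deriv (fun s => deriv (fun y => f y s) x) t := by
  have hd : Differentiable ℝ (Function.uncurry f) := hf.differentiable (by simp)
  have hd' : Differentiable ℝ (fderiv ℝ (Function.uncurry f)) :=
    (hf.fderiv_right (m := (⊤ : ℕ∞)) (by simp)).differentiable (by simp)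
  have hsymm : IsSymmSndFDerivAt ℝ (Function.uncurry f) (x, t) :=
    hf.contDiffAt.isSymmSndFDerivAt (by
      rw [minSmoothness_of_isRCLikeNormedField]
      exact WithTop.coe_le_coe.2 le_top)
  have hx : HasDerivAt (fun y => fderiv ℝ (Function.uncurry f) (y, t))
      (fderiv ℝ (fderiv ℝ (Function.uncurry f)) (x, t) (1, 0)) x :=
    (hd' (x, t)).hasFDerivAt.comp_hasDerivAt x ((hasDerivAt_id x).prodMk (hasDerivAt_const x t))
  have ht : HasDerivAt (fun s => fderiv ℝ (Function.uncurry f) (x, s))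
      (fderiv ℝ (fderiv ℝ (Function.uncurry f)) (x, t) (0, 1)) t :=
    (hd' (x, t)).hasFDerivAt.comp_hasDerivAt t ((hasDerivAt_const t x).prodMk (hasDerivAt_id t))
  simp only [deriv_fst_eq_fderiv hd, deriv_snd_eq_fderiv hd]
  have hx' := (hx.clm_apply (hasDerivAt_const x ((0 : ℝ), (1 : ℝ)))).deriv
  have ht' := (ht.clm_apply (hasDerivAt_const t ((1 : ℝ), (0 : ℝ)))).deriv
  simp only [map_zero, add_zero] at hx' ht'
  rw [hx', ht', hsymm (1, 0) (0, 1)]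

end PartialDerivatives

theorem hasDerivAt_er (x : ℝ) : HasDerivAt er (etheta x) x :=
  (Real.hasDerivAt_cos x).prodMk (Real.hasDerivAt_sin x)

theorem hasDerivAt_etheta (x : ℝ) : HasDerivAt etheta (-er x) x :=
  (Real.hasDerivAt_sin x).neg.prodMk (Real.hasDerivAt_cos x)

theorem smul_er_add_smul_etheta_inj {x b c b' c' : ℝ}
    (h : b • er x + c • etheta x = b' • er x + c' • etheta x) : b = b' ∧ c = c' := by
  have h1 := congrArg Prod.fst h
  have h2 := congrArg Prod.snd h
  simp only [er, etheta, Prod.fst_add, Prod.snd_add, Prod.smul_fst, Prod.smul_snd,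
    smul_eq_mul] at h1 h2
  have h3 := Real.sin_sq_add_cos_sq x
  constructor
  · linear_combination Real.cos x * h1 + Real.sin x * h2 - (b - b') * h3
  · linear_combination -Real.sin x * h1 + Real.cos x * h2 - (c - c') * h3

/-- Two differentiable functions agreeing on `[0, T)` have the same derivative there. -/
theorem HasDerivAt.eq_of_eqOn_Ico {E : Type*} [NormedAddCommGroup E] [NormedSpace ℝ E]
    {T t : ℝ} {g h : ℝ → E} {g' h' : E} (ht : t ∈ Set.Ico 0 T) (hg : HasDerivAt g g' t)
    (hh : HasDerivAt h h' t) (hgh : Set.EqOn g h (Set.Ico 0 T)) : g' = h' :=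
  (uniqueDiffOn_Ico 0 T t ht).eq_deriv _ hg.hasDerivWithinAt
    (hh.hasDerivWithinAt.congr hgh (hgh ht))

theorem stmt0
    (T : ℝ) (hT : 0 < T)
    (a : ℝ → ℝ → ℝ) (ha : ContDiff ℝ (⊤ : ℕ∞) (Function.uncurry a))
    (haper : ∀ θ t, a (θ + π) t = a θ t)
    (hapos : ∀ θ t, t ∈ Set.Ico 0 T → 0 < a θ t)
    (haapos : ∀ θ t, t ∈ Set.Ico 0 T → 0 < a θ t + pd (pd a) θ t)
    (p q : ℝ → ℝ → ℝ × ℝ)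
    (hp : ∀ θ t, p θ t = a θ t • er θ + pd a θ t • etheta θ)
    (hq : ∀ θ t, q θ t = (a θ t)⁻¹ • etheta θ)
    (F : ℝ → ℝ → ℝ × ℝ) (hF : ContDiff ℝ (⊤ : ℕ∞) (Function.uncurry F))
    (hFper : ∀ u t, F (u + 2 * π) t = F u t)
    (Θ : ℝ → ℝ → ℝ) (hΘsm : ContDiff ℝ (⊤ : ℕ∞) (Function.uncurry Θ))
    (hΘper : ∀ u t, Θ (u + 2 * π) t = Θ u t + 2 * π)
    (hΘu : ∀ u t, t ∈ Set.Ico 0 T → 0 < pd Θ u t)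
    (v : ℝ → ℝ → ℝ) (hvsm : ContDiff ℝ (⊤ : ℕ∞) (Function.uncurry v))
    (hvpos : ∀ u t, t ∈ Set.Ico 0 T → 0 < v u t)
    (k : ℝ → ℝ → ℝ)
    (hk : ∀ u t, k u t =
      a (Θ u t) t * (a (Θ u t) t + pd (pd a) (Θ u t) t) * pd Θ u t / v u t)
    (hFu : ∀ u t, t ∈ Set.Ico 0 T → pdv F u t = v u t • q (Θ u t) t)
    (hFt : ∀ u t, t ∈ Set.Ico 0 T → ptv F u t = (-(k u t)) • p (Θ u t) t)
    :
    ∀ u t, t ∈ Set.Ico 0 T →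
      pt v u t
        = -(k u t) ^ 2 * v u t
          + pt (fun x s => Real.log (a x s)) (Θ u t) t * v u t := by
  intro u t ht
  have hda : Differentiable ℝ (Function.uncurry a) := ha.differentiable (by simp)
  have ha1 : ContDiff ℝ (⊤ : ℕ∞) (Function.uncurry (pd a)) := contDiff_deriv_fst ha
  have ha2 : ContDiff ℝ (⊤ : ℕ∞) (Function.uncurry (pd (pd a))) := contDiff_deriv_fst ha1
  have hΘ1 : ContDiff ℝ (⊤ : ℕ∞) (Function.uncurry (pd Θ)) := contDiff_deriv_fst hΘsm
  have hdΘ : Differentiable ℝ (Function.uncurry Θ) := hΘsm.differentiable (by simp)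
  have hdv : Differentiable ℝ (Function.uncurry v) := hvsm.differentiable (by simp)
  have slice_u {f : ℝ → ℝ → ℝ} (hf : Differentiable ℝ (Function.uncurry f)) :
      HasDerivAt (fun x => f x t) (pd f u t) u :=
    (hasDerivAt_uncurry_comp hf (hasDerivAt_id u)
      (hasDerivAt_const u t)).differentiableAt.hasDerivAt
  have slice_t {f : ℝ → ℝ → ℝ} (hf : Differentiable ℝ (Function.uncurry f)) (x : ℝ) :
      HasDerivAt (fun s => f x s) (pt f x t) t :=
    (hasDerivAt_uncurry_comp hf (hasDerivAt_const t x)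
      (hasDerivAt_id t)).differentiableAt.hasDerivAt
  have along_u {f : ℝ → ℝ → ℝ} (hf : Differentiable ℝ (Function.uncurry f)) :
      HasDerivAt (fun x => f (Θ x t) t) (pd Θ u t * pd f (Θ u t) t) u := by
    simpa [pd] using hasDerivAt_uncurry_comp_partials hf (slice_u hdΘ) (hasDerivAt_const u t)
  have hΘu' := slice_u hdΘ
  have hΘt' := slice_t hdΘ u
  have hvne : v u t ≠ 0 := (hvpos u t ht).ne'
  have hane : a (Θ u t) t ≠ 0 := (hapos _ t ht).ne'
  have haΘt : HasDerivAt (fun s => a (Θ u s) s)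
      (pt Θ u t * pd a (Θ u t) t + pt a (Θ u t) t) t := by
    simpa [pd, pt] using hasDerivAt_uncurry_comp_partials hda hΘt' (hasDerivAt_id t)
  have hku : HasDerivAt (fun x => k x t) (pd k u t) u := by
    have haΘ := along_u hda
    have h := ((haΘ.mul (haΘ.add (along_u (ha2.differentiable (by simp))))).mul
      (slice_u (hΘ1.differentiable (by simp)))).div (slice_u hdv) hvne
    exact (h.congr_of_eventuallyEq (.of_forall fun x => hk x t)).differentiableAt.hasDerivAt
  have hFut : HasDerivAt (fun s => pdv F u s) (deriv (fun s => pdv F u s) t) t :=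
    (hasDerivAt_uncurry_comp ((contDiff_deriv_fst hF).differentiable (by simp))
      (hasDerivAt_const t u) (hasDerivAt_id t)).differentiableAt.hasDerivAt
  have hcomm : deriv (fun x => ptv F x t) u = deriv (fun s => pdv F u s) t :=
    deriv_deriv_comm hF u t
  have eq_t := hFut.eq_of_eqOn_Ico ht
    ((slice_t hdv u).smul ((haΘt.inv hane).smul ((hasDerivAt_etheta _).scomp t hΘt')))
    (fun s hs => (hFu u s hs).trans (by rw [hq]; rfl))
  have eq_u := (hku.neg.smul (((along_u hda).smul ((hasDerivAt_er _).scomp u hΘu')).add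
    ((along_u (ha1.differentiable (by simp))).smul
      ((hasDerivAt_etheta _).scomp u hΘu')))).congr_of_eventuallyEq
    (f₁ := fun x => ptv F x t) (.of_forall fun x => (hFt x t ht).trans (by rw [hp]; rfl))
  rw [eq_u.deriv, eq_t] at hcomm
  have hlog : pt (fun x s => Real.log (a x s)) (Θ u t) t = pt a (Θ u t) t / a (Θ u t) t :=
    ((slice_t hda (Θ u t)).log hane).deriv
  simp only [Function.comp_apply, Pi.neg_apply, Pi.inv_apply, Pi.add_apply,
    Pi.smul_apply'] at hcomm
  set α := a (Θ u t) t
  set w := v u t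
  have hcoef : (-(pd k u t) * α) • er (Θ u t) +
      (-(k u t) * pd Θ u t * (α + pd (pd a) (Θ u t) t) - pd k u t * pd a (Θ u t) t)
        • etheta (Θ u t) =
      (-(w * pt Θ u t / α)) • er (Θ u t) +
      (pt v u t / α - w * (pt Θ u t * pd a (Θ u t) t + pt a (Θ u t) t) / α ^ 2)
        • etheta (Θ u t) := by
    convert hcomm using 1 <;> module
  obtain ⟨hr, hθ⟩ := smul_er_add_smul_etheta_inj hcoef
  have hkuv : pd k u t = w * pt Θ u t / α ^ 2 := by
    field_simp at hr ⊢
    linarith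
  have hkv : k u t * w = α * (α + pd (pd a) (Θ u t) t) * pd Θ u t := by
    rw [hk, div_mul_cancel₀ _ hvne]
  rw [hkuv] at hθ
  rw [hlog]
  field_simp at hθ ⊢
  linear_combination -hθ + α * k u t * hkv
end

section
/- Under the generalized Minkowski curvature flow, the enclosed area A(t) := (1/2)∫₀^{2π} [F(u,t), ∂F/∂u(u,t)] du satisfies dA/dt(t) = −∫₀^{2π} k(u,t)v(u,t) du = −2·A(𝒫_t), where A(𝒫_t) := (1/2)∫₀^{2π} [p(θ,t), p'(θ,t)] dθ = (1/2)∫₀^{2π} a(θ,t)(a(θ,t)+a''(θ,t)) dθ is the area of the unit ball 𝒫_t. -/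
open Real Set

open Function

section PartialDerivatives

variable {f : ℝ → ℝ → ℝ}

theorem pd_eq_fderiv (hf : ContDiff ℝ (⊤ : ℕ∞) (uncurry f)) (u t : ℝ) :
    pd f u t = fderiv ℝ (uncurry f) (u, t) (1, 0) := by
  have h : HasFDerivAt (uncurry f) (fderiv ℝ (uncurry f) (u, t)) (u, t) :=
    (hf.differentiable (by simp) _).hasFDerivAt
  exact (h.comp_hasDerivAt (f := fun x : ℝ => (x, t)) u
    ((hasDerivAt_id u).prodMk (hasDerivAt_const u t))).deriv

theorem pt_eq_fderiv (hf : ContDiff ℝ (⊤ : ℕ∞) (uncurry f)) (u t : ℝ) :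
    pt f u t = fderiv ℝ (uncurry f) (u, t) (0, 1) := by
  have h : HasFDerivAt (uncurry f) (fderiv ℝ (uncurry f) (u, t)) (u, t) :=
    (hf.differentiable (by simp) _).hasFDerivAt
  exact (h.comp_hasDerivAt (f := fun s : ℝ => (u, s)) t
    ((hasDerivAt_const t u).prodMk (hasDerivAt_id t))).deriv

theorem uncurry_pd (hf : ContDiff ℝ (⊤ : ℕ∞) (uncurry f)) :
    uncurry (pd f) = fun z => fderiv ℝ (uncurry f) z (1, 0) :=
  funext fun z => pd_eq_fderiv hf z.1 z.2

theorem uncurry_pt (hf : ContDiff ℝ (⊤ : ℕ∞) (uncurry f)) :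
    uncurry (pt f) = fun z => fderiv ℝ (uncurry f) z (0, 1) :=
  funext fun z => pt_eq_fderiv hf z.1 z.2

theorem contDiff_pd (hf : ContDiff ℝ (⊤ : ℕ∞) (uncurry f)) :
    ContDiff ℝ (⊤ : ℕ∞) (uncurry (pd f)) := by
  rw [uncurry_pd hf]
  exact (hf.fderiv_right (by simp)).clm_apply contDiff_const

theorem contDiff_pt (hf : ContDiff ℝ (⊤ : ℕ∞) (uncurry f)) :
    ContDiff ℝ (⊤ : ℕ∞) (uncurry (pt f)) := by
  rw [uncurry_pt hf]
  exact (hf.fderiv_right (by simp)).clm_apply contDiff_const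

theorem hasDerivAt_pd (hf : ContDiff ℝ (⊤ : ℕ∞) (uncurry f)) (u t : ℝ) :
    HasDerivAt (fun x => f x t) (pd f u t) u := by
  have h : ContDiff ℝ (⊤ : ℕ∞) (fun x => uncurry f (x, t)) := by fun_prop
  exact (h.differentiable (by simp) u).hasDerivAt

theorem hasDerivAt_pt (hf : ContDiff ℝ (⊤ : ℕ∞) (uncurry f)) (u t : ℝ) :
    HasDerivAt (fun s => f u s) (pt f u t) t := by
  have h : ContDiff ℝ (⊤ : ℕ∞) (fun s => uncurry f (u, s)) := by fun_prop
  exact (h.differentiable (by simp) t).hasDerivAt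

theorem continuous_slice (hf : ContDiff ℝ (⊤ : ℕ∞) (uncurry f)) (t : ℝ) :
    Continuous fun u => f u t :=
  hf.continuous.comp (by fun_prop : Continuous fun u : ℝ => (u, t))

theorem pt_pd_comm (hf : ContDiff ℝ (⊤ : ℕ∞) (uncurry f)) (u t : ℝ) :
    pt (pd f) u t = pd (pt f) u t := by
  have hd : DifferentiableAt ℝ (fderiv ℝ (uncurry f)) (u, t) :=
    ((hf.fderiv_right (m := (⊤ : ℕ∞)) (by simp)).differentiable (by simp)) _
  rw [pt_eq_fderiv (contDiff_pd hf), pd_eq_fderiv (contDiff_pt hf), uncurry_pd hf, uncurry_pt hf,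
    fderiv_clm_apply hd (by fun_prop), fderiv_clm_apply hd (by fun_prop)]
  have hs : IsSymmSndFDerivAt ℝ (uncurry f) (u, t) :=
    hf.contDiffAt.isSymmSndFDerivAt (by
      rw [minSmoothness_of_isRCLikeNormedField]
      exact WithTop.coe_le_coe.2 (le_top : (2 : ℕ∞) ≤ ⊤))
  simpa using hs (0, 1) (1, 0)

/-- Differentiation under the integral sign for smooth integrands. -/
theorem hasDerivAt_integral_pt (hf : ContDiff ℝ (⊤ : ℕ∞) (uncurry f)) (b c t : ℝ) :
    HasDerivAt (fun s => ∫ u in b..c, f u s) (∫ u in b..c, pt f u t) t := by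
  have hK : IsCompact (uIcc b c ×ˢ Metric.closedBall t 1) :=
    isCompact_uIcc.prod (isCompact_closedBall t 1)
  obtain ⟨C, hC⟩ := hK.exists_bound_of_continuousOn (contDiff_pt hf).continuous.continuousOn
  refine (intervalIntegral.hasDerivAt_integral_of_dominated_loc_of_deriv_le
    (F := fun s u => f u s) (F' := fun s u => pt f u s) (bound := fun _ => C)
    (Metric.closedBall_mem_nhds t one_pos) ?_ ?_ ?_ ?_ ?_ ?_).2
  · exact Filter.Eventually.of_forall fun s => (continuous_slice hf s).aestronglyMeasurable
  · exact (continuous_slice hf t).intervalIntegrable _ _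
  · exact (continuous_slice (contDiff_pt hf) t).aestronglyMeasurable
  · exact Filter.Eventually.of_forall fun u hu s hs => hC (u, s) ⟨uIoc_subset_uIcc hu, hs⟩
  · exact intervalIntegrable_const
  · exact Filter.Eventually.of_forall fun u _ s _ => hasDerivAt_pt hf u s

theorem periodic_pd {c d : ℝ} (hper : ∀ u t, f (u + c) t = f u t + d) (u t : ℝ) :
    pd f (u + c) t = pd f u t := by
  have h : (fun x => f (x + c) t) = fun x => f x t + d := funext fun x => hper x t
  rw [pd, ← deriv_comp_add_const, h, deriv_add_const, pd]

theorem periodic_pt {c : ℝ} (hper : ∀ u t, f (u + c) t = f u t) (u t : ℝ) :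
    pt f (u + c) t = pt f u t := by
  simp only [pt, hper]

end PartialDerivatives

/-- First variation of the area enclosed by a smooth family of closed curves. -/
theorem hasDerivAt_area {X Y : ℝ → ℝ → ℝ} {c : ℝ}
    (hX : ContDiff ℝ (⊤ : ℕ∞) (uncurry X)) (hY : ContDiff ℝ (⊤ : ℕ∞) (uncurry Y))
    (hXper : ∀ u t, X (u + c) t = X u t) (hYper : ∀ u t, Y (u + c) t = Y u t) (t : ℝ) :
    HasDerivAt (fun s => (1 / 2) * ∫ u in (0 : ℝ)..c, (X u s * pd Y u s - Y u s * pd X u s))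
      (∫ u in (0 : ℝ)..c, (pt X u t * pd Y u t - pt Y u t * pd X u t)) t := by
  have hG : ContDiff ℝ (⊤ : ℕ∞)
      (uncurry fun u s => X u s * pd Y u s - Y u s * pd X u s) :=
    (hX.mul (contDiff_pd hY)).sub (hY.mul (contDiff_pd hX))
  refine ((hasDerivAt_integral_pt hG 0 c t).const_mul (1 / 2 : ℝ)).congr_deriv ?_
  have hpt : ∀ u, pt (fun u s => X u s * pd Y u s - Y u s * pd X u s) u t =
      2 * (pt X u t * pd Y u t - pt Y u t * pd X u t) +
        (pd X u t * pt Y u t + X u t * pd (pt Y) u t -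
          (pd Y u t * pt X u t + Y u t * pd (pt X) u t)) := fun u => by
    have h := ((hasDerivAt_pt hX u t).mul (hasDerivAt_pt (contDiff_pd hY) u t)).sub
      ((hasDerivAt_pt hY u t).mul (hasDerivAt_pt (contDiff_pd hX) u t))
    refine h.deriv.trans ?_
    rw [pt_pd_comm hX, pt_pd_comm hY]
    ring
  have cX := continuous_slice hX t
  have cY := continuous_slice hY t
  have cXu := continuous_slice (contDiff_pd hX) t
  have cYu := continuous_slice (contDiff_pd hY) t
  have cXt := continuous_slice (contDiff_pt hX) t
  have cYt := continuous_slice (contDiff_pt hY) t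
  have cXtu := continuous_slice (contDiff_pd (contDiff_pt hX)) t
  have cYtu := continuous_slice (contDiff_pd (contDiff_pt hY)) t
  have hexact : ∫ u in (0 : ℝ)..c, (pd X u t * pt Y u t + X u t * pd (pt Y) u t -
      (pd Y u t * pt X u t + Y u t * pd (pt X) u t)) = 0 := by
    rw [intervalIntegral.integral_eq_sub_of_hasDerivAt
      (f := fun u => X u t * pt Y u t - Y u t * pt X u t)
      (fun u _ => ((hasDerivAt_pd hX u t).mul (hasDerivAt_pd (contDiff_pt hY) u t)).sub
        ((hasDerivAt_pd hY u t).mul (hasDerivAt_pd (contDiff_pt hX) u t)))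
      (Continuous.intervalIntegrable (by fun_prop) _ _)]
    have h₁ := hXper 0 t
    have h₂ := hYper 0 t
    have h₃ := periodic_pt hXper 0 t
    have h₄ := periodic_pt hYper 0 t
    rw [zero_add] at h₁ h₂ h₃ h₄
    rw [h₁, h₂, h₃, h₄, sub_self]
  simp only [hpt]
  rw [intervalIntegral.integral_add (Continuous.intervalIntegrable (by fun_prop) _ _)
    (Continuous.intervalIntegrable (by fun_prop) _ _), hexact,
    intervalIntegral.integral_const_mul]
  ring

theorem stmt1
    (T : ℝ) (hT : 0 < T)
    (a : ℝ → ℝ → ℝ) (ha : ContDiff ℝ (⊤ : ℕ∞) (Function.uncurry a))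
    (haper : ∀ θ t, a (θ + π) t = a θ t)
    (hapos : ∀ θ t, t ∈ Set.Ico 0 T → 0 < a θ t)
    (haapos : ∀ θ t, t ∈ Set.Ico 0 T → 0 < a θ t + pd (pd a) θ t)
    (p q : ℝ → ℝ → ℝ × ℝ)
    (hp : ∀ θ t, p θ t = a θ t • er θ + pd a θ t • etheta θ)
    (hq : ∀ θ t, q θ t = (a θ t)⁻¹ • etheta θ)
    (F : ℝ → ℝ → ℝ × ℝ) (hF : ContDiff ℝ (⊤ : ℕ∞) (Function.uncurry F))
    (hFper : ∀ u t, F (u + 2 * π) t = F u t)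
    (Θ : ℝ → ℝ → ℝ) (hΘsm : ContDiff ℝ (⊤ : ℕ∞) (Function.uncurry Θ))
    (hΘper : ∀ u t, Θ (u + 2 * π) t = Θ u t + 2 * π)
    (hΘu : ∀ u t, t ∈ Set.Ico 0 T → 0 < pd Θ u t)
    (v : ℝ → ℝ → ℝ) (hvsm : ContDiff ℝ (⊤ : ℕ∞) (Function.uncurry v))
    (hvpos : ∀ u t, t ∈ Set.Ico 0 T → 0 < v u t)
    (k : ℝ → ℝ → ℝ)
    (hk : ∀ u t, k u t =
      a (Θ u t) t * (a (Θ u t) t + pd (pd a) (Θ u t) t) * pd Θ u t / v u t)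
    (hFu : ∀ u t, t ∈ Set.Ico 0 T → pdv F u t = v u t • q (Θ u t) t)
    (hFt : ∀ u t, t ∈ Set.Ico 0 T → ptv F u t = (-(k u t)) • p (Θ u t) t)
    (A AP : ℝ → ℝ)
    (hA : ∀ t, A t = (1 / 2) * ∫ u in (0:ℝ)..2 * π, wedge (F u t) (pdv F u t))
    (hAP : ∀ t, AP t = (1 / 2) * ∫ θ in (0:ℝ)..2 * π, a θ t * (a θ t + pd (pd a) θ t)) :
    ∀ t ∈ Set.Ico 0 T,
      deriv A t = -(∫ u in (0:ℝ)..2 * π, k u t * v u t) ∧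
      deriv A t = -2 * AP t := by
  have hX : ContDiff ℝ (⊤ : ℕ∞) (uncurry fun u t => (F u t).1) := contDiff_fst.comp hF
  have hY : ContDiff ℝ (⊤ : ℕ∞) (uncurry fun u t => (F u t).2) := contDiff_snd.comp hF
  have hpdv : ∀ u t, pdv F u t = (pd (fun u t => (F u t).1) u t, pd (fun u t => (F u t).2) u t) :=
    fun u t => ((hasDerivAt_pd hX u t).prodMk (hasDerivAt_pd hY u t)).deriv
  have hptv : ∀ u t, ptv F u t = (pt (fun u t => (F u t).1) u t, pt (fun u t => (F u t).2) u t) :=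
    fun u t => ((hasDerivAt_pt hX u t).prodMk (hasDerivAt_pt hY u t)).deriv
  intro t ht
  have hAeq : A = fun s => (1 / 2) * ∫ u in (0 : ℝ)..2 * π,
      ((F u s).1 * pd (fun u t => (F u t).2) u s - (F u s).2 * pd (fun u t => (F u t).1) u s) := by
    funext s
    simp only [hA, hpdv, wedge]
  have hpq : ∀ θ, wedge (p θ t) (q θ t) = 1 := fun θ => by
    have h0 := (hapos θ t ht).ne'
    simp only [hp, hq, wedge, er, etheta, Prod.smul_mk, Prod.mk_add_mk, smul_eq_mul]
    field_simp
    linear_combination a θ t * Real.cos_sq_add_sin_sq θ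
  have hderiv : deriv A t = -(∫ u in (0:ℝ)..2 * π, k u t * v u t) := by
    rw [hAeq, (hasDerivAt_area hX hY (fun u t => by rw [hFper]) (fun u t => by rw [hFper]) t).deriv,
      ← intervalIntegral.integral_neg]
    refine intervalIntegral.integral_congr fun u _ => ?_
    have hw : wedge (ptv F u t) (pdv F u t) = -(k u t * v u t) := by
      have h := hpq (Θ u t)
      rw [hFu u t ht, hFt u t ht]
      simp only [wedge, Prod.smul_fst, Prod.smul_snd, smul_eq_mul] at h ⊢
      linear_combination (-(k u t * v u t)) * h
    simpa only [hptv, hpdv, wedge] using hw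
  refine ⟨hderiv, ?_⟩
  have hkv : ∀ u, k u t * v u t =
      ((fun θ => a θ t * (a θ t + pd (pd a) θ t)) ∘ fun u => Θ u t) u * pd Θ u t := fun u => by
    rw [hk, div_mul_cancel₀ _ (hvpos u t ht).ne', comp_apply]
  have hga : Continuous fun θ => a θ t * (a θ t + pd (pd a) θ t) :=
    (continuous_slice ha t).mul
      ((continuous_slice ha t).add (continuous_slice (contDiff_pd (contDiff_pd ha)) t))
  have haper₂ : ∀ θ s, a (θ + 2 * π) s = a θ s := fun θ s => by
    rw [two_mul, ← add_assoc, haper, haper]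
  have hgper : Periodic (fun θ => a θ t * (a θ t + pd (pd a) θ t)) (2 * π) := fun θ => by
    have h₁ : ∀ θ s, pd a (θ + 2 * π) s = pd a θ s + 0 := fun θ s => by
      rw [periodic_pd (d := 0) (fun θ s => by rw [haper₂, add_zero]), add_zero]
    simp only [haper₂, periodic_pd h₁]
  have hΘ₀ : Θ (2 * π) t = Θ 0 t + 2 * π := by simpa using hΘper 0 t
  have hsubst : ∫ u in (0:ℝ)..2 * π, k u t * v u t =
      ∫ θ in (0:ℝ)..2 * π, a θ t * (a θ t + pd (pd a) θ t) := by
    simp only [hkv]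
    rw [intervalIntegral.integral_comp_mul_deriv (fun u _ => hasDerivAt_pd hΘsm u t)
      (continuous_slice (contDiff_pd hΘsm) t).continuousOn hga, hΘ₀,
      hgper.intervalIntegral_add_eq (Θ 0 t) 0, zero_add]
  rw [hderiv, hsubst, hAP]
  ring
end

section
/- If t ↦ a(θ,t) + a''(θ,t) is nondecreasing for each θ (equivalently ∂/∂t log(a+a'') ≥ 0 on ℝ × [0,T₀)), then the minimum of the curvature is bounded below by its initial minimum: for all t ∈ [0,T₀), min_{θ∈[0,2π]} k(θ,t) ≥ min_{θ∈[0,2π]} k(θ,0) > 0. -/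
open Real Set

theorem IsLocalMin.deriv_deriv_nonneg_of_continuousAt {f : ℝ → ℝ} {x : ℝ}
    (h : IsLocalMin f x) (hc : ContinuousAt f x) : 0 ≤ deriv (deriv f) x := by
  by_contra! hneg
  have hmax : IsLocalMax f x := isLocalMax_of_deriv_deriv_neg hneg h.deriv_eq_zero hc
  have hconst : f =ᶠ[nhds x] fun _ => f x := by
    filter_upwards [h, hmax] with y hy hy' using le_antisymm hy' hy
  have hzero : deriv (deriv f) x = 0 := by
    rw [hconst.deriv.deriv_eq]
    simp
  exact hneg.ne hzero

theorem deriv_nonpos_of_forall_le_left {f : ℝ → ℝ} {s t : ℝ} (hst : s < t)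
    (hf : DifferentiableAt ℝ f t) (hmin : ∀ r ∈ Icc s t, f t ≤ f r) : deriv f t ≤ 0 := by
  have hlocal : IsLocalMinOn f (Icc s t) t := IsMinOn.localize hmin
  have hcone : s - t ∈ posTangentConeAt (Icc s t) t :=
    sub_mem_posTangentConeAt_of_segment_subset
      ((convex_Icc s t).segment_subset (right_mem_Icc.2 hst.le) (left_mem_Icc.2 hst.le))
  have h := hlocal.hasFDerivWithinAt_nonneg
    hf.hasDerivAt.hasFDerivAt.hasFDerivWithinAt hcone
  simp only [ContinuousLinearMap.toSpanSingleton_apply, smul_eq_mul] at h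
  nlinarith

theorem Function.Periodic.forall_le_of_forall_mem_Icc {f : ℝ → ℝ} {p m : ℝ}
    (hf : Function.Periodic f p) (hp : 0 < p) (h : ∀ x ∈ Icc 0 p, m ≤ f x) (x : ℝ) :
    m ≤ f x := by
  obtain ⟨y, hy, hxy⟩ := hf.exists_mem_Ico₀ hp x
  exact hxy ▸ h y (Ico_subset_Icc_self hy)

theorem stmt5
    (T : ℝ) (hT : 0 < T)
    (a : ℝ → ℝ → ℝ) (ha : ContDiff ℝ (⊤ : ℕ∞) (Function.uncurry a))
    (haper : ∀ θ t, a (θ + π) t = a θ t)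
    (hapos : ∀ θ t, t ∈ Set.Ico 0 T → 0 < a θ t)
    (haapos : ∀ θ t, t ∈ Set.Ico 0 T → 0 < a θ t + pd (pd a) θ t)
    (T₀ : ℝ) (hT₀ : 0 < T₀) (hT₀T : T₀ ≤ T)
    (k : ℝ → ℝ → ℝ) (hksm : ContDiff ℝ (⊤ : ℕ∞) (Function.uncurry k))
    (hkper : ∀ θ t, k (θ + 2 * π) t = k θ t)
    (hkpos : ∀ θ t, t ∈ Set.Ico 0 T₀ → 0 < k θ t)
    (hkevol : ∀ θ t, t ∈ Set.Ico 0 T₀ →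
      pt k θ t =
        a θ t / (a θ t + pd (pd a) θ t) * (k θ t) ^ 2 * pd (pd k) θ t
          + 2 * pd a θ t / (a θ t + pd (pd a) θ t) * (k θ t) ^ 2 * pd k θ t
          + (k θ t) ^ 3
          + pt (fun x s => Real.log (a x s + pd (pd a) x s)) θ t * k θ t)
    (hmono : ∀ θ, MonotoneOn (fun t => a θ t + pd (pd a) θ t) (Set.Ico 0 T₀)) :
    ∀ t ∈ Set.Ico 0 T₀,
      0 < sInf ((fun θ => k θ 0) '' Set.Icc 0 (2 * π)) ∧
      sInf ((fun θ => k θ 0) '' Set.Icc 0 (2 * π))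
        ≤ sInf ((fun θ => k θ t) '' Set.Icc 0 (2 * π)) := by
  have hπ : (0 : ℝ) < 2 * π := by positivity
  have hkc : Continuous (Function.uncurry k) := hksm.continuous
  have hkθ : ∀ t, Continuous fun θ => k θ t := fun t =>
    hkc.comp (by fun_prop : Continuous fun θ : ℝ => (θ, t))
  have hne : (Icc 0 (2 * π)).Nonempty := nonempty_Icc.2 hπ.le
  intro t ht
  refine ⟨?_, le_csInf (hne.image _) ?_⟩
  · obtain ⟨θ, -, hθ⟩ :=
      (isCompact_Icc.image (hkθ 0)).sInf_mem (hne.image _)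
    rw [← hθ]
    exact hkpos θ 0 ⟨le_rfl, hT₀⟩
  rintro _ ⟨θ, hθ, rfl⟩
  by_contra! hlt
  obtain ⟨⟨θm, tm⟩, ⟨hθm, htm⟩, hmin⟩ :=
    (isCompact_Icc.prod isCompact_Icc).exists_isMinOn
      (hne.prod (nonempty_Icc.2 ht.1)) hkc.continuousOn
  have hmin' : ∀ x ∈ Icc 0 (2 * π), ∀ s ∈ Icc 0 t, k θm tm ≤ k x s := fun x hx s hs =>
    hmin (show (x, s) ∈ Icc 0 (2 * π) ×ˢ Icc 0 t from ⟨hx, hs⟩)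
  have htm_pos : 0 < tm := by
    refine htm.1.lt_of_ne ?_
    rintro rfl
    have hbdd := (isCompact_Icc.image (hkθ 0)).bddBelow (s := (fun θ => k θ 0) '' Icc 0 (2 * π))
    have h₁ := csInf_le hbdd (mem_image_of_mem _ hθm)
    have h₂ := hmin' θ hθ t (right_mem_Icc.2 ht.1)
    exact (h₁.trans h₂).not_gt hlt
  have htmT : tm ∈ Ico 0 T₀ := ⟨htm.1, htm.2.trans_lt ht.2⟩
  have htmT' : tm ∈ Ico 0 T := ⟨htm.1, htmT.2.trans_le hT₀T⟩
  have hglobal : ∀ x, k θm tm ≤ k x tm :=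
    Function.Periodic.forall_le_of_forall_mem_Icc (fun x => hkper x tm) hπ
      fun x hx => hmin' x hx tm htm
  have hlocal : IsLocalMin (fun x => k x tm) θm := Filter.Eventually.of_forall hglobal
  have hk₁ : pd k θm tm = 0 := hlocal.deriv_eq_zero
  have hk₂ : 0 ≤ pd (pd k) θm tm :=
    hlocal.deriv_deriv_nonneg_of_continuousAt (hkθ tm).continuousAt
  have hkt : pt k θm tm ≤ 0 := by
    have hd : Differentiable ℝ fun s => k θm s :=
      (hksm.differentiable (by simp)).comp
        (by fun_prop : Differentiable ℝ fun s : ℝ => (θm, s))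
    exact deriv_nonpos_of_forall_le_left htm_pos (hd tm) fun r hr =>
      hmin' θm hθm r ⟨hr.1, hr.2.trans htm.2⟩
  have hlog : 0 ≤ pt (fun x s => Real.log (a x s + pd (pd a) x s)) θm tm := by
    have hlogmono : MonotoneOn (fun s => Real.log (a θm s + pd (pd a) θm s)) (Ico 0 T₀) :=
      fun r hr s hs hrs =>
        Real.log_le_log (haapos θm r ⟨hr.1, hr.2.trans_le hT₀T⟩) (hmono θm hr hs hrs)
    have h := hlogmono.derivWithin_nonneg (x := tm)
    rwa [derivWithin_of_mem_nhds (Ico_mem_nhds htm_pos htmT.2)] at h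
  have hkp := hkpos θm tm htmT
  have hdiff : 0 ≤ a θm tm / (a θm tm + pd (pd a) θm tm) * (k θm tm) ^ 2 * pd (pd k) θm tm :=
    mul_nonneg (mul_nonneg (div_pos (hapos θm tm htmT') (haapos θm tm htmT')).le (sq_nonneg _)) hk₂
  have hev := hkevol θm tm htmT
  rw [hk₁, mul_zero, add_zero] at hev
  linarith [mul_nonneg hlog hkp.le, pow_pos hkp 3]
end

section
/- Suppose the closing conditions ∫₀^{2π} ((a+a'')/k)(θ,t)·sin θ dθ = ∫₀^{2π} ((a+a'')/k)(θ,t)·cos θ dθ = 0 hold for all t ∈ [0,T₀). Then for each t ∈ [0,T₀) the curve θ ↦ F(θ,t) is closed, i.e. F(2π,t) = F(0,t), and satisfies ∂F/∂θ(θ,t) = ((a+a'')/k)(θ,t)·(−sin θ, cos θ); consequently ∂F/∂θ = λ(θ,t)·q(θ,t) with λ(θ,t) = (a(a+a'')/k)(θ,t) > 0, and the t-Minkowski curvature of F(·,t), defined as [p,p'](θ,t)/λ(θ,t), equals k(θ,t). -/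
open Real Set

theorem continuous_pd_pd {f : ℝ → ℝ → ℝ}
    (hf : ContDiff ℝ (⊤ : ℕ∞) (Function.uncurry f)) (t : ℝ) :
    Continuous (fun x => pd (pd f) x t) := by
  have hslice : ContDiff ℝ 2 (fun x => f x t) :=
    (hf.comp (contDiff_id.prodMk contDiff_const)).of_le (by norm_cast)
  have h := hslice.continuous_iteratedDeriv 2 le_rfl
  rwa [iteratedDeriv_succ, iteratedDeriv_one] at h

theorem wedge_er_etheta (θ b c d : ℝ) :
    wedge (b • er θ + c • etheta θ) (d • etheta θ) = b * d := by
  simp only [wedge, er, etheta, Prod.fst_add, Prod.snd_add, Prod.smul_fst, Prod.smul_snd,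
    smul_eq_mul]
  linear_combination b * d * Real.sin_sq_add_cos_sq θ

theorem stmt6
    (T : ℝ) (hT : 0 < T)
    (a : ℝ → ℝ → ℝ) (ha : ContDiff ℝ (⊤ : ℕ∞) (Function.uncurry a))
    (haper : ∀ θ t, a (θ + π) t = a θ t)
    (hapos : ∀ θ t, t ∈ Set.Ico 0 T → 0 < a θ t)
    (haapos : ∀ θ t, t ∈ Set.Ico 0 T → 0 < a θ t + pd (pd a) θ t)
    (T₀ : ℝ) (hT₀ : 0 < T₀) (hT₀T : T₀ ≤ T)
    (k : ℝ → ℝ → ℝ) (hksm : ContDiff ℝ (⊤ : ℕ∞) (Function.uncurry k))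
    (hkper : ∀ θ t, k (θ + 2 * π) t = k θ t)
    (hkpos : ∀ θ t, t ∈ Set.Ico 0 T₀ → 0 < k θ t)
    (hkevol : ∀ θ t, t ∈ Set.Ico 0 T₀ →
      pt k θ t =
        a θ t / (a θ t + pd (pd a) θ t) * (k θ t) ^ 2 * pd (pd k) θ t
          + 2 * pd a θ t / (a θ t + pd (pd a) θ t) * (k θ t) ^ 2 * pd k θ t
          + (k θ t) ^ 3
          + pt (fun x s => Real.log (a x s + pd (pd a) x s)) θ t * k θ t)
    (p q : ℝ → ℝ → ℝ × ℝ)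
    (hp : ∀ θ t, p θ t = a θ t • er θ + pd a θ t • etheta θ)
    (hq : ∀ θ t, q θ t = (a θ t)⁻¹ • etheta θ)
    (F : ℝ → ℝ → ℝ × ℝ)
    (hF : ∀ θ t, F θ t =
      (-(∫ σ in (0:ℝ)..θ, (a σ t + pd (pd a) σ t) / k σ t * Real.sin σ)
          - ∫ s in (0:ℝ)..t, a 0 s * k 0 s,
        (∫ σ in (0:ℝ)..θ, (a σ t + pd (pd a) σ t) / k σ t * Real.cos σ)
          - ∫ s in (0:ℝ)..t, (a 0 s * pd k 0 s + pd a 0 s * k 0 s)))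
    (hclose : ∀ t ∈ Set.Ico 0 T₀,
      (∫ θ in (0:ℝ)..2 * π, (a θ t + pd (pd a) θ t) / k θ t * Real.sin θ) = 0 ∧
      (∫ θ in (0:ℝ)..2 * π, (a θ t + pd (pd a) θ t) / k θ t * Real.cos θ) = 0) :
    ∀ t ∈ Set.Ico 0 T₀,
      F (2 * π) t = F 0 t ∧
      ∀ θ : ℝ,
        pdv F θ t = ((a θ t + pd (pd a) θ t) / k θ t) • (-Real.sin θ, Real.cos θ) ∧
        pdv F θ t = (a θ t * (a θ t + pd (pd a) θ t) / k θ t) • q θ t ∧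
        0 < a θ t * (a θ t + pd (pd a) θ t) / k θ t ∧
        wedge (p θ t) ((a θ t + pd (pd a) θ t) • etheta θ)
            / (a θ t * (a θ t + pd (pd a) θ t) / k θ t) = k θ t := by
  intro t ht
  have hk : ∀ θ, 0 < k θ t := fun θ => hkpos θ t ht
  have hT' : t ∈ Set.Ico 0 T := ⟨ht.1, ht.2.trans_le hT₀T⟩
  have hslice {f : ℝ → ℝ → ℝ} (hf : ContDiff ℝ (⊤ : ℕ∞) (Function.uncurry f)) :
      Continuous (fun x => f x t) :=
    hf.continuous.comp (continuous_id.prodMk continuous_const)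
  have hcont : Continuous (fun σ => (a σ t + pd (pd a) σ t) / k σ t) :=
    ((hslice ha).add (continuous_pd_pd ha t)).div (hslice hksm) fun σ => (hk σ).ne'
  refine ⟨?_, fun θ => ?_⟩
  · obtain ⟨h1, h2⟩ := hclose t ht
    simp [hF, h1, h2]
  have ha0 := hapos θ t hT'
  have haa0 := haapos θ t hT'
  have hk0 := hk θ
  have hderiv : pdv F θ t =
      ((a θ t + pd (pd a) θ t) / k θ t) • (-Real.sin θ, Real.cos θ) := by
    have hsin := ((hcont.mul Real.continuous_sin).integral_hasStrictDerivAt 0 θ).hasDerivAt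
    have hcos := ((hcont.mul Real.continuous_cos).integral_hasStrictDerivAt 0 θ).hasDerivAt
    have hd := (hsin.neg.sub_const (∫ s in (0:ℝ)..t, a 0 s * k 0 s)).prodMk
      (hcos.sub_const (∫ s in (0:ℝ)..t, (a 0 s * pd k 0 s + pd a 0 s * k 0 s)))
    have hfun : (fun x => F x t) = _ := funext fun x => hF x t
    rw [pdv, hfun]
    refine hd.deriv.trans ?_
    simp
  refine ⟨hderiv, ?_, by positivity, ?_⟩
  · rw [hderiv, hq, smul_smul, etheta]
    congr 1
    field_simp
  · rw [hp, wedge_er_etheta]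
    field_simp
end

section
/- For the homothetic family a(θ,t) = f(t)a₀(θ), suppose the closing conditions ∫₀^{2π} ((a₀+a₀'')/k)(θ,t)·sin θ dθ = ∫₀^{2π} ((a₀+a₀'')/k)(θ,t)·cos θ dθ = 0 hold for all t. Then the enclosed area A(t) := (1/2)∫₀^{2π} [F(θ,t), ∂F/∂θ(θ,t)] dθ (with [x,y] := x₁y₂ − x₂y₁) satisfies A(t) = A(0) − 2·A(𝒫₀)·∫₀^t f(s)² ds ≤ A(0) − 2t·A(𝒫₀) for all t ∈ [0,T), where A(𝒫₀) := (1/2)∫₀^{2π} a₀(θ)(a₀(θ)+a₀''(θ)) dθ; in particular, if A(t) > 0 then t < A(0)/(2·A(𝒫₀)). -/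
open Real Set

/-- Differentiation under the integral sign for jointly continuous data on a bounded interval. -/
lemma hasDerivAt_intervalIntegral_of_continuous {G G' : ℝ → ℝ → ℝ}
    (hG : Continuous fun p : ℝ × ℝ => G p.1 p.2) (hG' : Continuous fun p : ℝ × ℝ => G' p.1 p.2)
    (h : ∀ θ t, HasDerivAt (G θ) (G' θ t) t) (a b t : ℝ) :
    HasDerivAt (fun t => ∫ θ in a..b, G θ t) (∫ θ in a..b, G' θ t) t := by
  obtain ⟨K, hK⟩ := (isCompact_uIcc.prod (isCompact_Icc (a := t - 1) (b := t + 1))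
    : IsCompact (uIcc a b ×ˢ Icc (t - 1) (t + 1))).exists_bound_of_continuousOn hG'.continuousOn
  refine (intervalIntegral.hasDerivAt_integral_of_dominated_loc_of_deriv_le
    (F := fun t θ => G θ t) (F' := fun t θ => G' θ t) (bound := fun _ => K)
    (Icc_mem_nhds (by linarith : t - 1 < t) (by linarith : t < t + 1)) ?_ ?_ ?_ ?_ ?_ ?_).2
  · exact .of_forall fun s =>
      (hG.comp (Continuous.prodMk_left s)).aestronglyMeasurable
  · exact (hG.comp (Continuous.prodMk_left t)).intervalIntegrable _ _
  · exact (hG'.comp (Continuous.prodMk_left t)).aestronglyMeasurable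
  · exact .of_forall fun θ hθ s hs => hK (θ, s) ⟨uIoc_subset_uIcc hθ, hs⟩
  · exact intervalIntegrable_const
  · exact .of_forall fun θ _ s _ => h θ s

/-- Evolution of twice the area enclosed by a curve with radius of curvature `R`, when `R` evolves
by `∂R/∂t = -f (u'' + u)` and the curve is closed at time `t`. -/
lemma hasDerivAt_integral_cross {f : ℝ → ℝ} {u v w R : ℝ → ℝ → ℝ} {m : ℝ → ℝ} {b t : ℝ}
    (hf : Continuous f) (hu : Continuous fun p : ℝ × ℝ => u p.1 p.2)
    (hw : Continuous fun p : ℝ × ℝ => w p.1 p.2) (hR : Continuous fun p : ℝ × ℝ => R p.1 p.2)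
    (hm : Continuous m)
    (huv : ∀ θ t, HasDerivAt (fun x => u x t) (v θ t) θ)
    (hvw : ∀ θ t, HasDerivAt (fun x => v x t) (w θ t) θ)
    (hRt : ∀ θ t, HasDerivAt (R θ) (-(f t * (w θ t + u θ t))) t)
    (hRu : ∀ θ, R θ t * u θ t = f t * m θ)
    (hsin : ∫ σ in (0:ℝ)..b, R σ t * sin σ = 0) (hcos : ∫ σ in (0:ℝ)..b, R σ t * cos σ = 0) :
    HasDerivAt (fun s => ∫ θ in (0:ℝ)..b,
        ((∫ σ in (0:ℝ)..θ, R σ s * cos σ) * (R θ s * sin θ)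
          - (∫ σ in (0:ℝ)..θ, R σ s * sin σ) * (R θ s * cos θ)))
      (-(2 * f t ^ 2 * ∫ θ in (0:ℝ)..b, m θ)) t := by
  set C : ℝ → ℝ → ℝ := fun θ s => ∫ σ in (0:ℝ)..θ, R σ s * cos σ with hC
  set S : ℝ → ℝ → ℝ := fun θ s => ∫ σ in (0:ℝ)..θ, R σ s * sin σ with hS
  set Ct : ℝ → ℝ → ℝ := fun θ s => -(f s * (v θ s * cos θ + u θ s * sin θ - v 0 s)) with hCt
  set St : ℝ → ℝ → ℝ := fun θ s => -(f s * (v θ s * sin θ - u θ s * cos θ + u 0 s)) with hSt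
  set g : ℝ → ℝ → ℝ := fun θ s => -(f s * (w θ s + u θ s)) with hg
  have hgc : Continuous fun p : ℝ × ℝ => g p.1 p.2 := by fun_prop
  have hRθ (s : ℝ) : Continuous fun θ => R θ s := hR.comp (Continuous.prodMk_left s)
  have hgθ (s : ℝ) : Continuous fun θ => g θ s := hgc.comp (Continuous.prodMk_left s)
  have hSc : Continuous fun p : ℝ × ℝ => S p.1 p.2 :=
    intervalIntegral.continuous_parametric_intervalIntegral_of_continuous
      (f := fun (p : ℝ × ℝ) σ => R σ p.2 * sin σ)
      (Continuous.mul (hR.comp (by fun_prop : Continuous fun q : (ℝ × ℝ) × ℝ => (q.2, q.1.2)))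
        (by fun_prop)) continuous_fst
  have hCc : Continuous fun p : ℝ × ℝ => C p.1 p.2 :=
    intervalIntegral.continuous_parametric_intervalIntegral_of_continuous
      (f := fun (p : ℝ × ℝ) σ => R σ p.2 * cos σ)
      (Continuous.mul (hR.comp (by fun_prop : Continuous fun q : (ℝ × ℝ) × ℝ => (q.2, q.1.2)))
        (by fun_prop)) continuous_fst
  have hStθ (θ s : ℝ) : HasDerivAt (fun x => St x s) (g θ s * sin θ) θ := by
    have := (((((hvw θ s).mul (hasDerivAt_sin θ)).sub ((huv θ s).mul (hasDerivAt_cos θ))).add_const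
      (u 0 s)).const_mul (f s)).neg
    refine this.congr_deriv ?_
    simp only [hg]; ring
  have hCtθ (θ s : ℝ) : HasDerivAt (fun x => Ct x s) (g θ s * cos θ) θ := by
    have := (((((hvw θ s).mul (hasDerivAt_cos θ)).add ((huv θ s).mul (hasDerivAt_sin θ))).sub_const
      (v 0 s)).const_mul (f s)).neg
    refine this.congr_deriv ?_
    simp only [hg]; ring
  have hSt_eq (θ s : ℝ) : ∫ σ in (0:ℝ)..θ, g σ s * sin σ = St θ s := by
    rw [intervalIntegral.integral_eq_sub_of_hasDerivAt (fun x _ => hStθ x s)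
      (((hgθ s).mul continuous_sin).intervalIntegrable _ _)]
    simp [hSt]
  have hCt_eq (θ s : ℝ) : ∫ σ in (0:ℝ)..θ, g σ s * cos σ = Ct θ s := by
    rw [intervalIntegral.integral_eq_sub_of_hasDerivAt (fun x _ => hCtθ x s)
      (((hgθ s).mul continuous_cos).intervalIntegrable _ _)]
    simp [hCt]
  have hS_t (θ s : ℝ) : HasDerivAt (S θ) (St θ s) s := by
    rw [← hSt_eq]
    exact hasDerivAt_intervalIntegral_of_continuous (G := fun σ s => R σ s * sin σ)
      (G' := fun σ s => g σ s * sin σ) (by fun_prop) (by fun_prop)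
      (fun σ s => (hRt σ s).mul_const _) 0 θ s
  have hC_t (θ s : ℝ) : HasDerivAt (C θ) (Ct θ s) s := by
    rw [← hCt_eq]
    exact hasDerivAt_intervalIntegral_of_continuous (G := fun σ s => R σ s * cos σ)
      (G' := fun σ s => g σ s * cos σ) (by fun_prop) (by fun_prop)
      (fun σ s => (hRt σ s).mul_const _) 0 θ s
  have hStc : Continuous fun p : ℝ × ℝ => St p.1 p.2 := by
    simp_rw [← hSt_eq]
    exact intervalIntegral.continuous_parametric_intervalIntegral_of_continuous
      (f := fun (p : ℝ × ℝ) σ => g σ p.2 * sin σ)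
      (Continuous.mul (hgc.comp (by fun_prop : Continuous fun q : (ℝ × ℝ) × ℝ => (q.2, q.1.2)))
        (by fun_prop)) continuous_fst
  have hCtc : Continuous fun p : ℝ × ℝ => Ct p.1 p.2 := by
    simp_rw [← hCt_eq]
    exact intervalIntegral.continuous_parametric_intervalIntegral_of_continuous
      (f := fun (p : ℝ × ℝ) σ => g σ p.2 * cos σ)
      (Continuous.mul (hgc.comp (by fun_prop : Continuous fun q : (ℝ × ℝ) × ℝ => (q.2, q.1.2)))
        (by fun_prop)) continuous_fst
  set E : ℝ → ℝ → ℝ := fun θ s => (Ct θ s * (R θ s * sin θ) + C θ s * (g θ s * sin θ))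
    - (St θ s * (R θ s * cos θ) + S θ s * (g θ s * cos θ)) with hE
  have hEc : Continuous fun p : ℝ × ℝ => E p.1 p.2 := by fun_prop
  have hSθ (θ : ℝ) : HasDerivAt (fun x => S x t) (R θ t * sin θ) θ :=
    ((hRθ t).mul continuous_sin).integral_hasStrictDerivAt 0 θ |>.hasDerivAt
  have hCθ (θ : ℝ) : HasDerivAt (fun x => C x t) (R θ t * cos θ) θ :=
    ((hRθ t).mul continuous_cos).integral_hasStrictDerivAt 0 θ |>.hasDerivAt
  have key : ∫ θ in (0:ℝ)..b, E θ t = -(2 * f t ^ 2 * ∫ θ in (0:ℝ)..b, m θ) := by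
    have hprim (θ : ℝ) : HasDerivAt
        (fun x => C x t * St x t - S x t * Ct x t - 2 * f t ^ 2 * (∫ σ in (0:ℝ)..x, m σ)
          + 2 * f t * v 0 t * S x t + 2 * f t * u 0 t * C x t) (E θ t) θ := by
      have := (((((hCθ θ).mul (hStθ θ t)).sub ((hSθ θ).mul (hCtθ θ t))).sub
        ((hm.integral_hasStrictDerivAt 0 θ).hasDerivAt.const_mul (2 * f t ^ 2))).add
        ((hSθ θ).const_mul (2 * f t * v 0 t))).add ((hCθ θ).const_mul (2 * f t * u 0 t))
      refine this.congr_deriv ?_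
      simp only [hE, hCt, hSt]
      linear_combination 2 * f t * hRu θ + (2 * f t * R θ t * u θ t) * sin_sq_add_cos_sq θ
    rw [intervalIntegral.integral_eq_sub_of_hasDerivAt (fun x _ => hprim x)
      ((hEc.comp (Continuous.prodMk_left t)).intervalIntegrable _ _)]
    have hSb : S b t = 0 := hsin
    have hCb : C b t = 0 := hcos
    have hS0 : S 0 t = 0 := intervalIntegral.integral_same
    have hC0 : C 0 t = 0 := intervalIntegral.integral_same
    simp [hSb, hCb, hS0, hC0]
  rw [← key]
  exact hasDerivAt_intervalIntegral_of_continuous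
    (G := fun θ s => C θ s * (R θ s * sin θ) - S θ s * (R θ s * cos θ)) (G' := E)
    (by fun_prop) hEc
    (fun θ s => ((hC_t θ s).mul ((hRt θ s).mul_const _)).sub
      ((hS_t θ s).mul ((hRt θ s).mul_const _))) 0 b t

lemma hasDerivAt_pd_s8 {k : ℝ → ℝ → ℝ} (hk : ContDiff ℝ (⊤ : ℕ∞) (Function.uncurry k)) (θ t : ℝ) :
    HasDerivAt (fun x => k x t) (pd k θ t) θ := by
  have : Differentiable ℝ fun x => k x t :=
    (hk.comp (contDiff_id.prodMk contDiff_const)).differentiable (by simp)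
  exact (this θ).hasDerivAt

lemma hasDerivAt_pt_s8 {k : ℝ → ℝ → ℝ} (hk : ContDiff ℝ (⊤ : ℕ∞) (Function.uncurry k)) (θ t : ℝ) :
    HasDerivAt (k θ) (pt k θ t) t := by
  have : Differentiable ℝ fun s => k θ s :=
    (hk.comp (contDiff_const.prodMk contDiff_id)).differentiable (by simp)
  exact (this t).hasDerivAt

lemma contDiff_pd_s8 {k : ℝ → ℝ → ℝ} (hk : ContDiff ℝ (⊤ : ℕ∞) (Function.uncurry k)) :
    ContDiff ℝ (⊤ : ℕ∞) (Function.uncurry (pd k)) := by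
  have h : Function.uncurry (pd k) = fun p => fderiv ℝ (Function.uncurry k) p (1, 0) := by
    ext ⟨θ, t⟩
    have h1 := ((hk.differentiable (by simp)) (θ, t)).hasFDerivAt.comp_hasDerivAt θ
      ((hasDerivAt_id θ).prodMk (hasDerivAt_const θ t))
    exact (hasDerivAt_pd_s8 hk θ t).unique h1
  rw [h]
  exact (hk.fderiv_right (by simp)).clm_apply contDiff_const

theorem stmt8
    (a₀ : ℝ → ℝ) (ha₀ : ContDiff ℝ (⊤ : ℕ∞) a₀)
    (ha₀per : ∀ θ, a₀ (θ + π) = a₀ θ)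
    (ha₀pos : ∀ θ, 0 < a₀ θ)
    (ha₀apos : ∀ θ, 0 < a₀ θ + deriv (deriv a₀) θ)
    (f : ℝ → ℝ) (hf : ContDiff ℝ (⊤ : ℕ∞) f)
    (hfpos : ∀ t, 0 ≤ t → 0 < f t)
    (hfmono : MonotoneOn f (Set.Ici 0))
    (hf0 : f 0 = 1)
    (T : ℝ) (hT : 0 < T)
    (k : ℝ → ℝ → ℝ) (hksm : ContDiff ℝ (⊤ : ℕ∞) (Function.uncurry k))
    (hkper : ∀ θ t, k (θ + 2 * π) t = k θ t)
    (hkpos : ∀ θ t, t ∈ Set.Ico 0 T → 0 < k θ t)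
    (hkevol : ∀ θ t, t ∈ Set.Ico 0 T →
      pt k θ t =
        a₀ θ / (a₀ θ + deriv (deriv a₀) θ) * (k θ t) ^ 2 * pd (pd k) θ t
          + 2 * deriv a₀ θ / (a₀ θ + deriv (deriv a₀) θ) * (k θ t) ^ 2 * pd k θ t
          + (k θ t) ^ 3
          + deriv f t / f t * k θ t)
    (F : ℝ → ℝ → ℝ × ℝ)
    (hF : ∀ θ t, F θ t =
      (-(∫ σ in (0:ℝ)..θ, f t * ((a₀ σ + deriv (deriv a₀) σ) / k σ t) * Real.sin σ)
          - ∫ s in (0:ℝ)..t, f s * a₀ 0 * k 0 s,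
        (∫ σ in (0:ℝ)..θ, f t * ((a₀ σ + deriv (deriv a₀) σ) / k σ t) * Real.cos σ)
          - ∫ s in (0:ℝ)..t, f s * (a₀ 0 * pd k 0 s + deriv a₀ 0 * k 0 s)))
    (hclose : ∀ t ∈ Set.Ico 0 T,
      (∫ θ in (0:ℝ)..2 * π, (a₀ θ + deriv (deriv a₀) θ) / k θ t * Real.sin θ) = 0 ∧
      (∫ θ in (0:ℝ)..2 * π, (a₀ θ + deriv (deriv a₀) θ) / k θ t * Real.cos θ) = 0)
    (A : ℝ → ℝ)
    (hA : ∀ t, A t = (1 / 2) * ∫ θ in (0:ℝ)..2 * π, wedge (F θ t) (pdv F θ t))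
    (AP₀ : ℝ)
    (hAP₀ : AP₀ = (1 / 2) * ∫ θ in (0:ℝ)..2 * π, a₀ θ * (a₀ θ + deriv (deriv a₀) θ)) :
    ∀ t ∈ Set.Ico 0 T,
      A t = A 0 - 2 * AP₀ * ∫ s in (0:ℝ)..t, f s ^ 2 ∧
      A t ≤ A 0 - 2 * t * AP₀ ∧
      (0 < A t → t < A 0 / (2 * AP₀)) := by
  have hd0 (θ : ℝ) : HasDerivAt a₀ (deriv a₀ θ) θ :=
    (ha₀.differentiable (by simp) θ).hasDerivAt
  have ha1 : ContDiff ℝ (⊤ : ℕ∞) (deriv a₀) := (contDiff_infty_iff_deriv.1 ha₀).2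
  have hd1 (θ : ℝ) : HasDerivAt (deriv a₀) (deriv (deriv a₀) θ) θ :=
    (ha1.differentiable (by simp) θ).hasDerivAt
  have ha2 : ContDiff ℝ (⊤ : ℕ∞) (deriv (deriv a₀)) := (contDiff_infty_iff_deriv.1 ha1).2
  have hdf (t : ℝ) : HasDerivAt f (deriv f t) t := (hf.differentiable (by simp) t).hasDerivAt
  have hk1 := contDiff_pd_s8 hksm
  have hk2 := contDiff_pd_s8 hk1
  have c0 : Continuous a₀ := ha₀.continuous
  have c1 : Continuous (deriv a₀) := ha1.continuous
  have c2 : Continuous (deriv (deriv a₀)) := ha2.continuous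
  have cf : Continuous f := hf.continuous
  have ck : Continuous fun p : ℝ × ℝ => k p.1 p.2 := hksm.continuous
  have ck1 : Continuous fun p : ℝ × ℝ => pd k p.1 p.2 := hk1.continuous
  have ck2 : Continuous fun p : ℝ × ℝ => pd (pd k) p.1 p.2 := hk2.continuous
  set q : ℝ → ℝ := fun θ => a₀ θ + deriv (deriv a₀) θ with hq
  have cq : Continuous q := c0.add c2
  set u : ℝ → ℝ → ℝ := fun θ t => a₀ θ * k θ t with hu
  set v : ℝ → ℝ → ℝ := fun θ t => deriv a₀ θ * k θ t + a₀ θ * pd k θ t with hv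
  set w : ℝ → ℝ → ℝ := fun θ t => (deriv (deriv a₀) θ * k θ t + deriv a₀ θ * pd k θ t)
    + (deriv a₀ θ * pd k θ t + a₀ θ * pd (pd k) θ t) with hw
  set g : ℝ → ℝ → ℝ := fun θ t => -(f t * (w θ t + u θ t)) with hg
  have cu : Continuous fun p : ℝ × ℝ => u p.1 p.2 := by fun_prop
  have cw : Continuous fun p : ℝ × ℝ => w p.1 p.2 := by fun_prop
  have cg : Continuous fun p : ℝ × ℝ => g p.1 p.2 := by fun_prop
  have cgt (θ : ℝ) : Continuous (g θ) := cg.comp (Continuous.prodMk_right θ)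
  have huv (θ t : ℝ) : HasDerivAt (fun x => u x t) (v θ t) θ :=
    (hd0 θ).mul (hasDerivAt_pd_s8 hksm θ t)
  have hvw (θ t : ℝ) : HasDerivAt (fun x => v x t) (w θ t) θ :=
    ((hd1 θ).mul (hasDerivAt_pd_s8 hksm θ t)).add ((hd0 θ).mul (hasDerivAt_pd_s8 hk1 θ t))
  set r : ℝ → ℝ → ℝ := fun θ t => f t * (q θ / k θ t) with hr
  have mem0 : (0 : ℝ) ∈ Set.Ico 0 T := ⟨le_rfl, hT⟩
  have crθ {t : ℝ} (ht : t ∈ Set.Ico 0 T) : Continuous fun θ => r θ t :=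
    continuous_const.mul (cq.div (ck.comp (Continuous.prodMk_left t)) fun θ => (hkpos θ t ht).ne')
  have hrt (θ : ℝ) {t : ℝ} (ht : t ∈ Set.Ico 0 T) : HasDerivAt (r θ) (g θ t) t := by
    have hk0 := (hkpos θ t ht).ne'
    have hf0' := (hfpos t ht.1).ne'
    have hq0 : a₀ θ + deriv (deriv a₀) θ ≠ 0 := (ha₀apos θ).ne'
    refine ((hdf t).mul ((hasDerivAt_const t (q θ)).div (hasDerivAt_pt_s8 hksm θ t) hk0)).congr_deriv ?_
    rw [hkevol θ t ht]
    simp only [hg, hw, hu, hq, Pi.div_apply]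
    field_simp
    ring
  -- `R` agrees with the radius of curvature `r` on `[0, T)` and is differentiable for all times.
  set R : ℝ → ℝ → ℝ := fun θ t => r θ 0 + ∫ s in (0:ℝ)..t, g θ s with hRdef
  have hRr (θ : ℝ) {t : ℝ} (ht : t ∈ Set.Ico 0 T) : R θ t = r θ t := by
    have := intervalIntegral.integral_eq_sub_of_hasDerivAt (a := 0) (b := t) (f := r θ) (f' := g θ)
      (fun s hs => by
        rw [uIcc_of_le ht.1] at hs
        exact hrt θ ⟨hs.1, hs.2.trans_lt ht.2⟩) ((cgt θ).intervalIntegrable _ _)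
    simp only [hRdef, this]
    ring
  have cR : Continuous fun p : ℝ × ℝ => R p.1 p.2 := by
    refine ((crθ mem0).comp continuous_fst).add ?_
    exact intervalIntegral.continuous_parametric_intervalIntegral_of_continuous
      (f := fun (p : ℝ × ℝ) s => g p.1 s)
      (cg.comp (by fun_prop : Continuous fun x : (ℝ × ℝ) × ℝ => (x.1.1, x.2))) continuous_snd
  have hRt (θ t : ℝ) : HasDerivAt (R θ) (g θ t) t :=
    (((cgt θ).integral_hasStrictDerivAt 0 t).hasDerivAt).const_add _
  have hRsin {t : ℝ} (ht : t ∈ Set.Ico 0 T) : ∫ σ in (0:ℝ)..2 * π, R σ t * sin σ = 0 := by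
    simp only [hRr _ ht, hr, mul_assoc]
    rw [intervalIntegral.integral_const_mul, (hclose t ht).1, mul_zero]
  have hRcos {t : ℝ} (ht : t ∈ Set.Ico 0 T) : ∫ σ in (0:ℝ)..2 * π, R σ t * cos σ = 0 := by
    simp only [hRr _ ht, hr, mul_assoc]
    rw [intervalIntegral.integral_const_mul, (hclose t ht).2, mul_zero]
  set B : ℝ → ℝ := fun s => ∫ θ in (0:ℝ)..2 * π,
        ((∫ σ in (0:ℝ)..θ, R σ s * cos σ) * (R θ s * sin θ)
          - (∫ σ in (0:ℝ)..θ, R σ s * sin σ) * (R θ s * cos θ)) with hB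
  have hBt {t : ℝ} (ht : t ∈ Set.Ico 0 T) : HasDerivAt B (-(4 * AP₀) * f t ^ 2) t := by
    refine (hasDerivAt_integral_cross (m := fun θ => a₀ θ * q θ) cf cu cw cR (c0.mul cq) huv hvw hRt
      (fun θ => ?_) (hRsin ht) (hRcos ht)).congr_deriv ?_
    · have := (hkpos θ t ht).ne'
      rw [hRr θ ht]
      simp only [hr, hu]
      field_simp
    · rw [hAP₀]; ring
  have hAB {t : ℝ} (ht : t ∈ Set.Ico 0 T) : A t = 1 / 2 * B t := by
    have crt : Continuous fun θ => R θ t := cR.comp (Continuous.prodMk_left t)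
    have cs : Continuous fun θ => R θ t * sin θ := crt.mul continuous_sin
    have cc : Continuous fun θ => R θ t * cos θ := crt.mul continuous_cos
    obtain ⟨x, y, hxy⟩ : ∃ x y : ℝ, ∀ θ, F θ t =
        (-(∫ σ in (0:ℝ)..θ, R σ t * sin σ) - x, (∫ σ in (0:ℝ)..θ, R σ t * cos σ) - y) :=
      ⟨_, _, fun θ => by simp only [hRr _ ht, hr]; exact hF θ t⟩
    have hpd (θ : ℝ) : pdv F θ t = (-(R θ t * sin θ), R θ t * cos θ) := by
      have hfun : (fun x => F x t) = _ := funext hxy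
      rw [pdv, hfun]
      exact (((cs.integral_hasStrictDerivAt 0 θ).hasDerivAt.neg.sub_const x).prodMk
        ((cc.integral_hasStrictDerivAt 0 θ).hasDerivAt.sub_const y)).deriv
    have cS : Continuous fun θ => ∫ σ in (0:ℝ)..θ, R σ t * sin σ :=
      intervalIntegral.continuous_primitive (fun _ _ => cs.intervalIntegrable _ _) 0
    have cC : Continuous fun θ => ∫ σ in (0:ℝ)..θ, R σ t * cos σ :=
      intervalIntegral.continuous_primitive (fun _ _ => cc.intervalIntegrable _ _) 0
    have hsplit (θ : ℝ) : wedge (F θ t) (pdv F θ t) =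
        ((∫ σ in (0:ℝ)..θ, R σ t * cos σ) * (R θ t * sin θ)
          - (∫ σ in (0:ℝ)..θ, R σ t * sin σ) * (R θ t * cos θ))
          - (x * (R θ t * cos θ) + y * (R θ t * sin θ)) := by
      rw [hpd, hxy, wedge]; ring
    rw [hA]
    simp only [hsplit]
    have i₁ : Continuous fun θ => (∫ σ in (0:ℝ)..θ, R σ t * cos σ) * (R θ t * sin θ)
          - (∫ σ in (0:ℝ)..θ, R σ t * sin σ) * (R θ t * cos θ) := (cC.mul cs).sub (cS.mul cc)
    have i₂ : Continuous fun θ => x * (R θ t * cos θ) := cc.const_mul x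
    have i₃ : Continuous fun θ => y * (R θ t * sin θ) := cs.const_mul y
    rw [intervalIntegral.integral_sub (i₁.intervalIntegrable _ _)
      ((i₂.fun_add i₃).intervalIntegrable _ _),
      intervalIntegral.integral_add (i₂.intervalIntegrable _ _) (i₃.intervalIntegrable _ _),
      intervalIntegral.integral_const_mul,
      intervalIntegral.integral_const_mul, hRsin ht, hRcos ht]
    simp [hB]
  have hAP₀pos : 0 < AP₀ := by
    rw [hAP₀]
    refine mul_pos (by norm_num) (intervalIntegral.intervalIntegral_pos_of_pos
      ((c0.mul cq).intervalIntegrable _ _) (fun θ => mul_pos (ha₀pos θ) (ha₀apos θ)) two_pi_pos)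
  intro t ht
  have harea : A t = A 0 - 2 * AP₀ * ∫ s in (0:ℝ)..t, f s ^ 2 := by
    have := intervalIntegral.integral_eq_sub_of_hasDerivAt (a := 0) (b := t) (f := B)
      (f' := fun s => -(4 * AP₀) * f s ^ 2)
      (fun s hs => by
        rw [uIcc_of_le ht.1] at hs
        exact hBt ⟨hs.1, hs.2.trans_lt ht.2⟩)
      ((by fun_prop : Continuous fun s => -(4 * AP₀) * f s ^ 2).intervalIntegrable _ _)
    rw [intervalIntegral.integral_const_mul] at this
    rw [hAB ht, hAB mem0]
    linarith
  have hint : t ≤ ∫ s in (0:ℝ)..t, f s ^ 2 := by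
    have := intervalIntegral.integral_mono_on (μ := MeasureTheory.volume)
      (f := fun _ => (1 : ℝ)) (g := fun s => f s ^ 2) ht.1
      intervalIntegrable_const ((cf.pow 2).intervalIntegrable _ _)
      (fun s hs => one_le_pow₀ (hf0 ▸ hfmono self_mem_Ici hs.1 hs.1))
    simpa using this
  have hle : A t ≤ A 0 - 2 * t * AP₀ := by
    rw [harea]
    nlinarith [mul_le_mul_of_nonneg_left hint hAP₀pos.le]
  refine ⟨harea, hle, fun hpos => ?_⟩
  rw [lt_div_iff₀ (by positivity)]
  linarith
end

section
/- For every t ∈ [0,T), the entropy-type quantity satisfies the identity d/dt ( ∫₀^{2π} a₀(θ)(a₀(θ)+a₀''(θ))·log( k(θ,t)/f(t) ) dθ ) = ∫₀^{2π} ( a₀(θ)k(θ,t) )² − ( ∂/∂θ ( a₀(θ)k(θ,t) ) )² dθ. -/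
open Real Set

/-- Differentiation under the integral sign over a compact interval, for a jointly continuous
derivative. -/
theorem hasDerivAt_intervalIntegral_of_continuousOn {F F' : ℝ → ℝ → ℝ} {a b t δ : ℝ}
    (hab : a ≤ b) (hδ : 0 < δ)
    (hF : ∀ s ∈ Metric.closedBall t δ, ContinuousOn (fun x => F x s) (Icc a b))
    (hF' : ContinuousOn (Function.uncurry F') (Icc a b ×ˢ Metric.closedBall t δ))
    (hderiv : ∀ x ∈ Icc a b, ∀ s ∈ Metric.closedBall t δ, HasDerivAt (F x) (F' x s) s) :
    HasDerivAt (fun s => ∫ x in a..b, F x s) (∫ x in a..b, F' x t) t := by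
  have ht : t ∈ Metric.closedBall t δ := Metric.mem_closedBall_self hδ.le
  have hI : Set.uIoc a b ⊆ Icc a b := by
    rw [Set.uIoc_of_le hab]; exact Ioc_subset_Icc_self
  obtain ⟨C, hC⟩ := (isCompact_Icc.prod (isCompact_closedBall t δ)).exists_bound_of_continuousOn hF'
  have hF't : ContinuousOn (fun x => F' x t) (Icc a b) :=
    hF'.comp (f := fun x => (x, t)) (by fun_prop) fun x hx => ⟨hx, ht⟩
  refine (intervalIntegral.hasDerivAt_integral_of_dominated_loc_of_deriv_le
    (F := fun s x => F x s) (F' := fun s x => F' x s) (bound := fun _ => C)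
    (Metric.ball_mem_nhds t hδ) ?_ ?_ ?_ ?_ ?_ ?_).2
  · filter_upwards [Metric.ball_mem_nhds t hδ] with s hs
    exact ((hF s (Metric.ball_subset_closedBall hs)).mono hI).aestronglyMeasurable
      measurableSet_uIoc
  · exact ContinuousOn.intervalIntegrable (by rw [Set.uIcc_of_le hab]; exact hF t ht)
  · exact (hF't.mono hI).aestronglyMeasurable measurableSet_uIoc
  · exact Filter.Eventually.of_forall fun x hx s hs =>
      hC (x, s) ⟨hI hx, Metric.ball_subset_closedBall hs⟩
  · exact intervalIntegrable_const
  · exact Filter.Eventually.of_forall fun x hx s hs =>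
      hderiv x (hI hx) s (Metric.ball_subset_closedBall hs)

/-- Along a compact interval, joint positivity at time `t` persists on a closed time ball. -/
theorem exists_closedBall_pos {g : ℝ × ℝ → ℝ} (hg : Continuous g) {a b t : ℝ}
    (hpos : ∀ x ∈ Icc a b, 0 < g (x, t)) :
    ∃ δ > 0, ∀ x ∈ Icc a b, ∀ s ∈ Metric.closedBall t δ, 0 < g (x, s) := by
  obtain ⟨u, v, -, hv, hu, htv, huv⟩ := generalized_tube_lemma (isCompact_Icc (a := a) (b := b))
    (isCompact_singleton (x := t)) (isOpen_lt continuous_const hg)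
    (by rintro ⟨x, s⟩ ⟨hx, rfl⟩; exact hpos x hx)
  obtain ⟨δ, hδ, hball⟩ := Metric.nhds_basis_closedBall.mem_iff.1
    (hv.mem_nhds (htv rfl))
  exact ⟨δ, hδ, fun x hx s hs => huv (Set.mk_mem_prod (hu hx) (hball hs))⟩

/-- The time derivative of a smooth function of two variables is jointly continuous. -/
theorem continuous_uncurry_pt {k : ℝ → ℝ → ℝ} (hk : ContDiff ℝ 1 (Function.uncurry k)) :
    Continuous (Function.uncurry (pt k)) := by
  have h : Function.uncurry (pt k) =
      fun p => fderiv ℝ (Function.uncurry k) p ((0 : ℝ), (1 : ℝ)) := by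
    funext p
    obtain ⟨x, s⟩ := p
    have h1 := (hk.differentiable one_ne_zero (x, s)).hasFDerivAt
    have h2 : HasDerivAt (fun r : ℝ => (x, r)) ((0 : ℝ), (1 : ℝ)) s :=
      (hasDerivAt_const s x).prodMk (hasDerivAt_id s)
    exact (h1.comp_hasDerivAt s h2).deriv
  rw [h]
  exact (hk.continuous_fderiv one_ne_zero).clm_apply continuous_const

/-- The integral over a period of the derivative of a periodic function vanishes. -/
theorem Function.Periodic.integral_deriv_eq_zero {G : ℝ → ℝ} {c : ℝ} (hper : G.Periodic c)
    (hG : ContDiff ℝ 1 G) : ∫ x in (0 : ℝ)..c, deriv G x = 0 := by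
  rw [intervalIntegral.integral_deriv_eq_sub
    (fun x _ => hG.differentiable one_ne_zero x)
    ((hG.continuous_deriv le_rfl).intervalIntegrable _ _)]
  simpa using sub_eq_zero.2 (hper 0)

theorem stmt11
    (a₀ : ℝ → ℝ) (ha₀ : ContDiff ℝ (⊤ : ℕ∞) a₀)
    (ha₀per : ∀ θ, a₀ (θ + π) = a₀ θ)
    (ha₀pos : ∀ θ, 0 < a₀ θ)
    (ha₀apos : ∀ θ, 0 < a₀ θ + deriv (deriv a₀) θ)
    (f : ℝ → ℝ) (hf : ContDiff ℝ (⊤ : ℕ∞) f)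
    (hfpos : ∀ t, 0 ≤ t → 0 < f t)
    (hfmono : MonotoneOn f (Set.Ici 0))
    (hf0 : f 0 = 1)
    (T : ℝ) (hT : 0 < T)
    (k : ℝ → ℝ → ℝ) (hksm : ContDiff ℝ (⊤ : ℕ∞) (Function.uncurry k))
    (hkper : ∀ θ t, k (θ + 2 * π) t = k θ t)
    (hkpos : ∀ θ t, t ∈ Set.Ico 0 T → 0 < k θ t)
    (hkevol : ∀ θ t, t ∈ Set.Ico 0 T →
      pt k θ t =
        a₀ θ / (a₀ θ + deriv (deriv a₀) θ) * (k θ t) ^ 2 * pd (pd k) θ t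
          + 2 * deriv a₀ θ / (a₀ θ + deriv (deriv a₀) θ) * (k θ t) ^ 2 * pd k θ t
          + (k θ t) ^ 3
          + deriv f t / f t * k θ t)
    :
    ∀ t ∈ Set.Ico 0 T,
      deriv (fun s => ∫ θ in (0:ℝ)..2 * π,
          a₀ θ * (a₀ θ + deriv (deriv a₀) θ) * Real.log (k θ s / f s)) t
        = ∫ θ in (0:ℝ)..2 * π,
            (a₀ θ * k θ t) ^ 2 - (deriv (fun x => a₀ x * k x t) θ) ^ 2 := by
  intro t ht
  have hkx : ∀ s, ContDiff ℝ (⊤ : ℕ∞) (fun x => k x s) := fun s =>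
    hksm.comp (contDiff_id.prodMk contDiff_const)
  have hks : ∀ x, ContDiff ℝ (⊤ : ℕ∞) (fun s => k x s) := fun x =>
    hksm.comp (contDiff_const.prodMk contDiff_id)
  have hda : ContDiff ℝ (⊤ : ℕ∞) (deriv a₀) := (contDiff_infty_iff_deriv.1 ha₀).2
  have hdda : ContDiff ℝ (⊤ : ℕ∞) (deriv (deriv a₀)) := (contDiff_infty_iff_deriv.1 hda).2
  have hdk : ContDiff ℝ (⊤ : ℕ∞) (fun x => pd k x t) := (contDiff_infty_iff_deriv.1 (hkx t)).2
  have hdf : Continuous (deriv f) := (contDiff_infty_iff_deriv.1 hf).2.continuous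
  have hkc : Continuous (Function.uncurry k) := hksm.continuous
  have hptc := continuous_uncurry_pt (hksm.of_le (by exact_mod_cast le_top))
  have hac := ha₀.continuous
  have hddac := hdda.continuous
  have hfc := hf.continuous
  obtain ⟨δ₁, hδ₁, hkball⟩ := exists_closedBall_pos hkc (a := 0) (b := 2 * π) (t := t)
    fun x _ => hkpos x t ht
  obtain ⟨δ₂, hδ₂, hfball⟩ := exists_closedBall_pos (hfc.comp continuous_snd)
    (a := 0) (b := 2 * π) (t := t) fun x _ => hfpos t ht.1
  have h0 : (0 : ℝ) ∈ Icc 0 (2 * π) := ⟨le_rfl, by positivity⟩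
  have hkne : ∀ x ∈ Icc 0 (2 * π), ∀ s ∈ Metric.closedBall t (min δ₁ δ₂), k x s ≠ 0 :=
    fun x hx s hs => (hkball x hx s (Metric.closedBall_subset_closedBall (min_le_left _ _) hs)).ne'
  have hfne : ∀ s ∈ Metric.closedBall t (min δ₁ δ₂), f s ≠ 0 :=
    fun s hs => (hfball 0 h0 s (Metric.closedBall_subset_closedBall (min_le_right _ _) hs)).ne'
  have key : HasDerivAt (fun s => ∫ θ in (0:ℝ)..2 * π,
      a₀ θ * (a₀ θ + deriv (deriv a₀) θ) * Real.log (k θ s / f s))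
      (∫ θ in (0:ℝ)..2 * π, a₀ θ * (a₀ θ + deriv (deriv a₀) θ) *
        (pt k θ t / k θ t - deriv f t / f t)) t := by
    refine hasDerivAt_intervalIntegral_of_continuousOn
      (F := fun θ s => a₀ θ * (a₀ θ + deriv (deriv a₀) θ) * Real.log (k θ s / f s))
      (F' := fun θ s => a₀ θ * (a₀ θ + deriv (deriv a₀) θ) *
        (pt k θ s / k θ s - deriv f s / f s)) h0.2 (lt_min hδ₁ hδ₂) ?_ ?_ ?_
    · intro s hs
      refine ContinuousOn.mul (by fun_prop) (ContinuousOn.log ?_ fun x hx =>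
        div_ne_zero (hkne x hx s hs) (hfne s hs))
      exact ((hkx s).continuous.div_const _).continuousOn
    · refine ContinuousOn.mul (by fun_prop) (ContinuousOn.sub ?_ ?_)
      · exact hptc.continuousOn.div hkc.continuousOn fun p hp => hkne p.1 hp.1 p.2 hp.2
      · exact (hdf.comp continuous_snd).continuousOn.div (hfc.comp continuous_snd).continuousOn
          fun p hp => hfne p.2 hp.2
    · intro x hx s hs
      have hk0 := hkne x hx s hs
      have hf0 := hfne s hs
      have h1 : HasDerivAt (k x) (pt k x s) s :=
        ((hks x).differentiable (by simp) s).hasDerivAt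
      have h2 : HasDerivAt f (deriv f s) s := (hf.differentiable (by simp) s).hasDerivAt
      refine (((h1.div h2 hf0).log (div_ne_zero hk0 hf0)).const_mul _).congr_deriv ?_
      simp only [Pi.div_apply]
      field_simp
  have hakd : ∀ θ, HasDerivAt (fun x => a₀ x * k x t)
      (deriv a₀ θ * k θ t + a₀ θ * pd k θ t) θ := fun θ =>
    (ha₀.differentiable (by simp) θ).hasDerivAt.mul
      ((hkx t).differentiable (by simp) θ).hasDerivAt
  have hak : ContDiff ℝ (⊤ : ℕ∞) (fun x => a₀ x * k x t) := ha₀.mul (hkx t)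
  have hdak : ContDiff ℝ (⊤ : ℕ∞) (deriv fun x => a₀ x * k x t) :=
    (contDiff_infty_iff_deriv.1 hak).2
  have hper : Function.Periodic (fun x => a₀ x * k x t) (2 * π) := fun x => by
    have := ha₀per (x + π)
    rw [add_assoc, ← two_mul, ha₀per] at this
    simp only [this, hkper]
  have hdper : Function.Periodic (deriv fun x => a₀ x * k x t) (2 * π) := fun x => by
    rw [← deriv_comp_add_const, hper.funext]
  have hG : ContDiff ℝ (⊤ : ℕ∞)
      ((fun x => a₀ x * k x t) * deriv fun x => a₀ x * k x t) := hak.mul hdak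
  have hGd : ∀ θ, deriv ((fun x => a₀ x * k x t) * deriv fun x => a₀ x * k x t) θ =
      (deriv a₀ θ * k θ t + a₀ θ * pd k θ t) ^ 2 + a₀ θ * k θ t *
        (deriv (deriv a₀) θ * k θ t + 2 * deriv a₀ θ * pd k θ t + a₀ θ * pd (pd k) θ t) := by
    intro θ
    have h1 : HasDerivAt (deriv fun x => a₀ x * k x t)
        (deriv (deriv a₀) θ * k θ t + deriv a₀ θ * pd k θ t +
          (deriv a₀ θ * pd k θ t + a₀ θ * pd (pd k) θ t)) θ := by
      rw [funext fun x => (hakd x).deriv]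
      exact ((hda.differentiable (by simp) θ).hasDerivAt.mul
        ((hkx t).differentiable (by simp) θ).hasDerivAt).add
        ((ha₀.differentiable (by simp) θ).hasDerivAt.mul
        (hdk.differentiable (by simp) θ).hasDerivAt)
    rw [((hakd θ).mul h1).deriv, (hakd θ).deriv]
    ring
  have hzero := (hper.mul hdper).integral_deriv_eq_zero (hG.of_le (by exact_mod_cast le_top))
  have hsplit : ∀ θ, a₀ θ * (a₀ θ + deriv (deriv a₀) θ) *
      (pt k θ t / k θ t - deriv f t / f t) =
      ((a₀ θ * k θ t) ^ 2 - (deriv (fun x => a₀ x * k x t) θ) ^ 2) +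
        deriv ((fun x => a₀ x * k x t) * deriv fun x => a₀ x * k x t) θ := by
    intro θ
    have hk0 := (hkpos θ t ht).ne'
    have hf0 := (hfpos t ht.1).ne'
    have ha0 := (ha₀apos θ).ne'
    rw [hGd, (hakd θ).deriv, hkevol θ t ht]
    field_simp
    ring
  rw [key.deriv, intervalIntegral.integral_congr fun θ _ => hsplit θ,
    intervalIntegral.integral_add, hzero, add_zero]
  · exact ((hak.continuous.pow 2).sub (hdak.continuous.pow 2)).intervalIntegrable _ _
  · exact (contDiff_infty_iff_deriv.1 hG).2.continuous.intervalIntegrable _ _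
end
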